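/- arXiv:1106.2334 — 4 statements merged into one kernel-verified Lean document; each statement's English description precedes it below -/
import Mathlib

section
/- Let φ : ℝ⁴ → ℝ be smooth and let Γ^a_{bc}(x) = t_b t_c ∂^aφ(x) be the Christoffel symbols of the geometrized Newtonian connection associated with φ. Then its Riemann curvature tensor satisfies, for all x ∈ ℝ⁴ and all indices a,b,c,d, R^a_{bcd}(x) = t_b t_d ∂_c ∂^aφ(x) − t_b t_c ∂_d ∂^aφ(x). -/
/-- Partial derivative in the `a`-th coordinate direction on `ℝ⁴`. -/
noncomputable def pd (a : Fin 4) (f : (Fin 4 → ℝ) → ℝ) (x : Fin 4 → ℝ) : ℝ :=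
  fderiv ℝ f x (Pi.single a 1)

/-- The temporal covector `t_a`: `t_0 = 1`, `t_1 = t_2 = t_3 = 0`. -/
def tcov (a : Fin 4) : ℝ := if a = 0 then 1 else 0

/-- The spatial metric `h^{ab} = diag(0,1,1,1)`. -/
def hmat (a b : Fin 4) : ℝ := if a = b ∧ a ≠ 0 then 1 else 0

/-- The raised spatial gradient `∂^a φ = Σ_b h^{ab} ∂_b φ`. -/
noncomputable def gradUp (φ : (Fin 4 → ℝ) → ℝ) (a : Fin 4) (x : Fin 4 → ℝ) : ℝ :=
  ∑ b, hmat a b * pd b φ x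

/-- Christoffel symbols `Γ^a_{bc} = t_b t_c ∂^a φ` of the geometrized Newtonian connection. -/
noncomputable def chris (φ : (Fin 4 → ℝ) → ℝ) (a b c : Fin 4) (x : Fin 4 → ℝ) : ℝ :=
  tcov b * tcov c * gradUp φ a x

/-- Riemann curvature tensor
`R^a_{bcd} = ∂_c Γ^a_{db} − ∂_d Γ^a_{cb} + Σ_e (Γ^a_{ce} Γ^e_{db} − Γ^a_{de} Γ^e_{cb})`. -/
noncomputable def riem (φ : (Fin 4 → ℝ) → ℝ) (a b c d : Fin 4) (x : Fin 4 → ℝ) : ℝ :=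
  pd c (chris φ a d b) x - pd d (chris φ a c b) x
    + ∑ e, (chris φ a c e x * chris φ e d b x - chris φ a d e x * chris φ e c b x)

theorem pd_const_mul (a : Fin 4) (k : ℝ) (f : (Fin 4 → ℝ) → ℝ) (x : Fin 4 → ℝ) :
    pd a (fun y => k * f y) x = k * pd a f x := by
  change fderiv ℝ (k • f) x _ = _
  rw [fderiv_const_smul_field]
  rfl

/-- The covector `t` annihilates raised gradients. -/
theorem tcov_mul_gradUp (φ : (Fin 4 → ℝ) → ℝ) (a : Fin 4) (x : Fin 4 → ℝ) :
    tcov a * gradUp φ a x = 0 := by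
  by_cases h : a = 0 <;> simp [tcov, gradUp, hmat, h]

theorem pd_chris (φ : (Fin 4 → ℝ) → ℝ) (a b c d : Fin 4) (x : Fin 4 → ℝ) :
    pd d (chris φ a b c) x = tcov b * tcov c * pd d (gradUp φ a) x :=
  pd_const_mul d _ (gradUp φ a) x

theorem chris_mul_chris (φ : (Fin 4 → ℝ) → ℝ) (a b c d e : Fin 4) (x : Fin 4 → ℝ) :
    chris φ a c e x * chris φ e d b x = 0 := by
  unfold chris
  linear_combination tcov c * gradUp φ a x * tcov d * tcov b * tcov_mul_gradUp φ e x

/-- For the geometrized Newtonian connection with `Γ^a_{bc} = t_b t_c ∂^a φ`, the Riemann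
tensor is `R^a_{bcd} = t_b t_d ∂_c ∂^a φ − t_b t_c ∂_d ∂^a φ`. -/
theorem stmt_4 (φ : (Fin 4 → ℝ) → ℝ) (hφ : ContDiff ℝ (⊤ : ℕ∞) φ)
    (x : Fin 4 → ℝ) (a b c d : Fin 4) :
    riem φ a b c d x =
      tcov b * tcov d * pd c (gradUp φ a) x - tcov b * tcov c * pd d (gradUp φ a) x := by
  simp only [riem, pd_chris, chris_mul_chris, sub_self, Finset.sum_const_zero]
  ring
end

section
/- Let φ : ℝ⁴ → ℝ be smooth and let R^a_{bcd} be the Riemann curvature tensor of the geometrized Newtonian connection associated with φ. Then the curvature condition CC3 of the Trautman Geometrization Lemma holds: for all x ∈ ℝ⁴ and all indices a,b,c,d, Σ_n h^{bn} R^a_{ncd}(x) = 0. -/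
theorem chris_eq_zero_of_right_ne_zero (φ : (Fin 4 → ℝ) → ℝ) (a b : Fin 4) {c : Fin 4}
    (hc : c ≠ 0) : chris φ a b c = 0 := by
  ext x
  simp [chris, tcov, hc]

theorem riem_eq_zero_of_ne_zero (φ : (Fin 4 → ℝ) → ℝ) (a : Fin 4) {b : Fin 4} (hb : b ≠ 0)
    (c d : Fin 4) (x : Fin 4 → ℝ) : riem φ a b c d x = 0 := by
  simp [riem, pd, chris_eq_zero_of_right_ne_zero φ _ _ hb]

/-- Curvature condition CC3 for the geometrized Newtonian connection:
`Σ_n h^{bn} R^a_{ncd} = 0` for all `x` and all indices `a, b, c, d`. -/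
theorem stmt_7 (φ : (Fin 4 → ℝ) → ℝ) (hφ : ContDiff ℝ (⊤ : ℕ∞) φ)
    (x : Fin 4 → ℝ) (a b c d : Fin 4) :
    (∑ n, hmat b n * riem φ a n c d x) = 0 := by
  refine Finset.sum_eq_zero fun n _ => ?_
  by_cases hn : n = 0
  · have hbn : hmat b n = 0 := if_neg fun h => h.2 (h.1.trans hn)
    rw [hbn, zero_mul]
  · rw [riem_eq_zero_of_ne_zero φ a hn, mul_zero]
end

section
/- Let k > 0. Suppose g : ℝ⁴ × [0,k) → M₄(ℝ) is smooth with each g(x,λ) a symmetric matrix, g(x,λ) invertible for every x and every λ ∈ (0,k), and g(x,0) = t(x) t(x)ᵀ for a smooth nonvanishing closed covector field t on ℝ⁴ (i.e. t(x) ≠ 0 and ∂_a t_b = ∂_b t_a everywhere). Suppose further H : ℝ⁴ × [0,k) → M₄(ℝ) is smooth with H(x,λ) = −λ · g(x,λ)⁻¹ for all λ ∈ (0,k), and set h^{ab}(x) := H(x,0). For λ ∈ (0,k) let Γ^a_{bc}(x,λ) = (1/2) Σ_d g^{ad}(x,λ) (∂_b g_{dc} + ∂_c g_{bd} − ∂_d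 g_{bc})(x,λ) be the Christoffel symbols of the Levi-Civita connection of g(·,λ). Then: (i) h^{ab}(x) t_b(x) = 0 for all x; (ii) Γ^a_{bc}(x,λ) extends to a smooth function on ℝ⁴ × [0,k); and (iii) the limit Christoffel symbols Γ^a_{bc}(x) := Γ^a_{bc}(x,0) are compatible with the classical metrics, i.e. ∂_a t_b(x) − Σ_c Γ^c_{ab}(x) t_c(x) = 0 and ∂_a h^{bc}(x) + Σ_d (Γ^b_{ad}(x) h^{dc}(x) + Γ^c_{ad}(x) h^{bd}(x)) = 0 for all x and all indices. -/
open Matrix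

/-- Christoffel symbols of the Levi-Civita connection of the metric `g(·,λ)`:
`Γ^a_{bc} = (1/2) Σ_d g^{ad} (∂_b g_{dc} + ∂_c g_{bd} − ∂_d g_{bc})`. -/
noncomputable def christoffel (g : (Fin 4 → ℝ) → ℝ → Matrix (Fin 4) (Fin 4) ℝ)
    (x : Fin 4 → ℝ) (l : ℝ) (a b c : Fin 4) : ℝ :=
  (1 / 2) * ∑ d, (g x l)⁻¹ a d *
    (pd b (fun y => g y l d c) x + pd c (fun y => g y l b d) x - pd d (fun y => g y l b c) x)

open Set Topology

section ParametricIntegral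

/-- The interval integral of a function jointly continuous on `s ×ˢ [a, b]` depends continuously
on the parameter. -/
theorem ContinuousOn.intervalIntegral_parametric {X F : Type*} [TopologicalSpace X]
    [NormedAddCommGroup F] [NormedSpace ℝ F] {s : Set X} {a b : ℝ} {f : X × ℝ → F}
    (hf : ContinuousOn f (s ×ˢ uIcc a b)) :
    ContinuousOn (fun p => ∫ r in a..b, f (p, r)) s := by
  have hslice : ∀ p ∈ s, ContinuousOn (fun r => f (p, r)) (uIcc a b) := fun p hp =>
    hf.comp (by fun_prop) fun r hr => ⟨hp, hr⟩
  intro p hp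
  rw [ContinuousWithinAt, Metric.tendsto_nhds]
  intro ε hε
  have hc : 0 < |b - a| + 1 := by positivity
  obtain ⟨v, hv, hvε⟩ := isCompact_uIcc.mem_uniformity_of_prod (f := fun p r => f (p, r)) hf hp
    (Metric.dist_mem_uniformity (div_pos hε hc))
  filter_upwards [hv, self_mem_nhdsWithin] with q hqv hq
  rw [dist_eq_norm, ← intervalIntegral.integral_sub (hslice q hq).intervalIntegrable
    (hslice p hp).intervalIntegrable]
  have hle : ‖∫ r in a..b, (f (q, r) - f (p, r))‖ ≤ ε / (|b - a| + 1) * |b - a| :=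
    intervalIntegral.norm_integral_le_of_norm_le_const fun r hr => by
      rw [← dist_eq_norm]
      exact (hvε q hqv r (uIoc_subset_uIcc hr)).le
  refine hle.trans_lt ?_
  rw [div_mul_eq_mul_div, div_lt_iff₀ hc]
  nlinarith

universe u

variable {E F : Type u} [NormedAddCommGroup E] [NormedSpace ℝ E]
  [NormedAddCommGroup F] [NormedSpace ℝ F]

/-- Differentiation under the integral sign on a convex set of parameters. -/
theorem hasFDerivWithinAt_intervalIntegral_of_continuousOn [CompleteSpace F] {s : Set E}
    (hs : Convex ℝ s) {a b : ℝ} {f : E × ℝ → F} {f' : E × ℝ → E →L[ℝ] F}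
    (hf : ContinuousOn f (s ×ˢ uIcc a b)) (hf' : ContinuousOn f' (s ×ˢ uIcc a b))
    (hd : ∀ p ∈ s, ∀ r ∈ uIcc a b, HasFDerivWithinAt (fun q => f (q, r)) (f' (p, r)) s p)
    {p : E} (hp : p ∈ s) :
    HasFDerivWithinAt (fun q => ∫ r in a..b, f (q, r)) (∫ r in a..b, f' (p, r)) s p := by
  have hslice : ∀ p ∈ s, ContinuousOn (fun r => f (p, r)) (uIcc a b) := fun p hp =>
    hf.comp (by fun_prop) fun r hr => ⟨hp, hr⟩
  have hslice' : ContinuousOn (fun r => f' (p, r)) (uIcc a b) :=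
    hf'.comp (by fun_prop) fun r hr => ⟨hp, hr⟩
  rw [hasFDerivWithinAt_iff_isLittleO, Asymptotics.isLittleO_iff]
  intro ε hε
  have hc : 0 < |b - a| + 1 := by positivity
  obtain ⟨v, hv, hvε⟩ := isCompact_uIcc.mem_uniformity_of_prod (f := fun p r => f' (p, r)) hf' hp
    (Metric.dist_mem_uniformity (div_pos hε hc))
  obtain ⟨δ, hδ, hball⟩ := Metric.mem_nhdsWithin_iff.1 hv
  filter_upwards [inter_mem_nhdsWithin s (Metric.ball_mem_nhds p hδ)] with q hq
  have hconv : Convex ℝ (s ∩ Metric.ball p δ) := hs.inter (convex_ball p δ)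
  have hint : (∫ r in a..b, f (q, r)) - (∫ r in a..b, f (p, r)) - (∫ r in a..b, f' (p, r)) (q - p)
      = ∫ r in a..b, (f (q, r) - f (p, r) - f' (p, r) (q - p)) := by
    rw [intervalIntegral.integral_sub, intervalIntegral.integral_sub,
      ContinuousLinearMap.intervalIntegral_apply]
    · exact hslice'.intervalIntegrable
    · exact (hslice q hq.1).intervalIntegrable
    · exact (hslice p hp).intervalIntegrable
    · exact ((hslice q hq.1).sub (hslice p hp)).intervalIntegrable
    · exact (hslice'.clm_apply continuousOn_const).intervalIntegrable
  rw [hint]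
  have hle : ‖∫ r in a..b, (f (q, r) - f (p, r) - f' (p, r) (q - p))‖
      ≤ ε / (|b - a| + 1) * ‖q - p‖ * |b - a| :=
    intervalIntegral.norm_integral_le_of_norm_le_const fun r hr => by
      have hr' := uIoc_subset_uIcc hr
      refine hconv.norm_image_sub_le_of_norm_hasFDerivWithin_le' (f := fun q => f (q, r))
        (f' := fun q => f' (q, r))
        (fun x hx => (hd x hx.1 r hr').mono inter_subset_left) (fun x hx => ?_)
        ⟨hp, Metric.mem_ball_self hδ⟩ hq
      rw [← dist_eq_norm]
      exact (hvε x (hball ⟨hx.2, hx.1⟩) r hr').le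
  refine hle.trans ?_
  have : ε / (|b - a| + 1) * |b - a| ≤ ε := by
    rw [div_mul_eq_mul_div, div_le_iff₀ hc]
    nlinarith
  nlinarith [norm_nonneg (q - p)]

/-- The interval integral of a function which is `C^n` on `s ×ˢ [a, b]` is a `C^n` function of the
parameter. -/
theorem ContDiffOn.intervalIntegral_parametric [CompleteSpace F] {s : Set E} (hs : Convex ℝ s)
    (hs' : UniqueDiffOn ℝ s) {a b : ℝ} (hab : a < b) {n : ℕ} {f : E × ℝ → F}
    (hf : ContDiffOn ℝ n f (s ×ˢ Icc a b)) :
    ContDiffOn ℝ n (fun p => ∫ r in a..b, f (p, r)) s := by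
  have hu : UniqueDiffOn ℝ (s ×ˢ Icc a b) := hs'.prod (uniqueDiffOn_Icc hab)
  have hI : uIcc a b = Icc a b := uIcc_of_le hab.le
  induction n generalizing F with
  | zero =>
    simp only [Nat.cast_zero, contDiffOn_zero] at hf ⊢
    rw [← hI] at hf
    exact hf.intervalIntegral_parametric
  | succ n ih =>
    push_cast at hf ⊢
    rw [contDiffOn_succ_iff_hasFDerivWithinAt_of_uniqueDiffOn hs']
    have hf'' : ContDiffOn ℝ n (fun p => (fderivWithin ℝ f (s ×ˢ Icc a b) p).comp
        (ContinuousLinearMap.inl ℝ E ℝ)) (s ×ˢ Icc a b) :=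
      (hf.fderivWithin hu le_rfl).clm_comp contDiffOn_const
    refine ⟨by simp, _, ih hf'', fun p hp => ?_⟩
    refine hasFDerivWithinAt_intervalIntegral_of_continuousOn
      (f' := fun p => (fderivWithin ℝ f (s ×ˢ Icc a b) p).comp (ContinuousLinearMap.inl ℝ E ℝ))
      hs (hI ▸ hf.continuousOn) (hI ▸ hf''.continuousOn) (fun p hp r hr => ?_) hp
    have hd := (hf.differentiableOn (by simp) (p, r) ⟨hp, hI ▸ hr⟩).hasFDerivWithinAt
    exact hd.comp p (hasFDerivAt_prodMk_left p r).hasFDerivWithinAt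
      fun q hq => mk_mem_prod hq (hI ▸ hr)

/-- **Hadamard's lemma** on a half-open strip: a smooth function on `E × [0, k)` vanishing on
`E × {0}` is the product of the second coordinate with a smooth function. -/
theorem ContDiffOn.exists_eq_smul_of_eq_zero [CompleteSpace F] {k : ℝ} {f : E × ℝ → F}
    (hf : ContDiffOn ℝ (⊤ : ℕ∞) f (univ ×ˢ Ico 0 k)) (hf0 : ∀ x, f (x, 0) = 0) :
    ∃ q : E × ℝ → F, ContDiffOn ℝ (⊤ : ℕ∞) q (univ ×ˢ Ico 0 k) ∧
      ∀ p ∈ (univ : Set E) ×ˢ Ico 0 k, f p = p.2 • q p := by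
  set S : Set (E × ℝ) := univ ×ˢ Ico 0 k with hS
  have hu : UniqueDiffOn ℝ S := uniqueDiffOn_univ.prod (uniqueDiffOn_Ico 0 k)
  have hconv : Convex ℝ S := convex_univ.prod (convex_Ico 0 k)
  let D : E × ℝ → F := fun p => fderivWithin ℝ f S p (0, 1)
  have hD : ContDiffOn ℝ (⊤ : ℕ∞) D S :=
    (hf.fderivWithin hu (by simp)).clm_apply contDiffOn_const
  have hmaps : MapsTo (fun z : (E × ℝ) × ℝ => (z.1.1, z.2 * z.1.2)) (S ×ˢ Icc 0 1) S := by
    rintro ⟨⟨x, l⟩, r⟩ ⟨⟨-, hl⟩, hr⟩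
    exact ⟨mem_univ _, mul_nonneg hr.1 hl.1, (mul_le_of_le_one_left hl.1 hr.2).trans_lt hl.2⟩
  have hDc : ContDiffOn ℝ (⊤ : ℕ∞) (fun z : (E × ℝ) × ℝ => D (z.1.1, z.2 * z.1.2))
      (S ×ˢ Icc 0 1) := hD.comp (ContDiff.contDiffOn (by fun_prop)) hmaps
  refine ⟨fun p => ∫ r in (0 : ℝ)..1, D (p.1, r * p.2), contDiffOn_infty.2 fun n =>
    (hDc.of_le (by exact_mod_cast le_top)).intervalIntegral_parametric hconv hu one_pos, ?_⟩
  rintro ⟨x, l⟩ hp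
  have hline : MapsTo (fun r : ℝ => (x, r * l)) (Icc 0 1) S := fun r hr => hmaps (x := ((x, l), r))
    ⟨hp, hr⟩
  have hderiv : ∀ r ∈ Icc (0 : ℝ) 1,
      HasDerivWithinAt (fun r => f (x, r * l)) (l • D (x, r * l)) (Icc 0 1) r := by
    intro r hr
    have h1 : HasDerivWithinAt (fun r : ℝ => (x, r * l)) (0, l) (Icc 0 1) r := by
      simpa using ((hasDerivAt_const r x).prodMk ((hasDerivAt_id r).mul_const l)).hasDerivWithinAt
    have h2 := (hf.differentiableOn (by simp) _ (hline hr)).hasFDerivWithinAt.comp_hasDerivWithinAt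
      r h1 hline
    have h3 : ((0 : E), l) = l • ((0 : E), (1 : ℝ)) := by simp
    rw [h3, map_smul] at h2
    exact h2
  have hDl : ContinuousOn (fun r : ℝ => D (x, r * l)) (Icc 0 1) :=
    hD.continuousOn.comp (by fun_prop) hline
  have hFTC := intervalIntegral.integral_eq_sub_of_hasDerivAt_of_le zero_le_one
    (fun r hr => (hderiv r hr).continuousWithinAt)
    (fun r hr => (hderiv r (Ioo_subset_Icc_self hr)).hasDerivAt (Icc_mem_nhds hr.1 hr.2))
    (ContinuousOn.intervalIntegrable (by
      rw [uIcc_of_le zero_le_one]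
      exact continuousOn_const.smul hDl))
  simp only [intervalIntegral.integral_smul, one_mul, zero_mul, hf0, sub_zero] at hFTC
  exact hFTC.symm

end ParametricIntegral

section ClassicalLimit

/-- A function continuous on `E × [0, k)` and vanishing on `E × (0, k)` vanishes on
`E × [0, k)`. -/
theorem eq_zero_of_continuousOn_prod_Ico {X : Type*} [TopologicalSpace X] {k : ℝ} {f : X × ℝ → ℝ}
    (hf : ContinuousOn f (univ ×ˢ Ico 0 k)) (h : ∀ x, ∀ l ∈ Ioo (0 : ℝ) k, f (x, l) = 0)
    (x : X) {l : ℝ} (hl : l ∈ Ico 0 k) : f (x, l) = 0 := by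
  have hlt : (0 : ℝ) < k := hl.1.trans_lt hl.2
  have heq : EqOn f (fun _ => 0) (univ ×ˢ Ioo 0 k) := fun p hp => h p.1 p.2 hp.2
  refine heq.of_subset_closure hf continuousOn_const (prod_mono_right Ioo_subset_Ico_self) ?_
    (mk_mem_prod (mem_univ x) hl)
  rw [closure_prod_eq, closure_univ, closure_Ioo hlt.ne]
  exact prod_mono_right Ico_subset_Icc_self

theorem hasFDerivAt_slice {k : ℝ} {f : (Fin 4 → ℝ) × ℝ → ℝ}
    (hf : ContDiffOn ℝ (⊤ : ℕ∞) f (univ ×ˢ Ico 0 k)) (x : Fin 4 → ℝ) {l : ℝ} (hl : l ∈ Ico 0 k) :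
    HasFDerivAt (fun y => f (y, l)) ((fderivWithin ℝ f (univ ×ˢ Ico 0 k) (x, l)).comp
      (ContinuousLinearMap.inl ℝ (Fin 4 → ℝ) ℝ)) x := by
  have hd := (hf.differentiableOn (by simp) (x, l) ⟨mem_univ x, hl⟩).hasFDerivWithinAt
  rw [← hasFDerivWithinAt_univ]
  exact hd.comp x (hasFDerivAt_prodMk_left x l).hasFDerivWithinAt
    fun y _ => mk_mem_prod (mem_univ y) hl

/-- Spatial partial derivatives of a smooth function on `ℝ⁴ × [0, k)` are smooth there. -/
theorem ContDiffOn.pd_slice {k : ℝ} {f : (Fin 4 → ℝ) × ℝ → ℝ}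
    (hf : ContDiffOn ℝ (⊤ : ℕ∞) f (univ ×ˢ Ico 0 k)) (a : Fin 4) :
    ContDiffOn ℝ (⊤ : ℕ∞) (fun p : (Fin 4 → ℝ) × ℝ => pd a (fun y => f (y, p.2)) p.1)
      (univ ×ˢ Ico 0 k) := by
  have hu : UniqueDiffOn ℝ ((univ : Set (Fin 4 → ℝ)) ×ˢ Ico 0 k) :=
    uniqueDiffOn_univ.prod (uniqueDiffOn_Ico 0 k)
  refine ((hf.fderivWithin hu (m := (⊤ : ℕ∞)) (by simp)).clm_apply
    (contDiffOn_const (c := (Pi.single a (1 : ℝ), (0 : ℝ))))).congr fun p hp => ?_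
  simp only [pd, (hasFDerivAt_slice hf p.1 hp.2).fderiv]
  rfl

theorem pd_mul (a : Fin 4) {u v : (Fin 4 → ℝ) → ℝ} {x : Fin 4 → ℝ} (hu : DifferentiableAt ℝ u x)
    (hv : DifferentiableAt ℝ v x) :
    pd a (fun y => u y * v y) x = pd a u x * v x + u x * pd a v x := by
  simp only [pd, fderiv_fun_mul hu hv]
  simp
  ring

/-- Differentiating a matrix product which is constant. -/
theorem sum_pd_mul_add_mul_pd_eq_zero (a : Fin 4) {U V : (Fin 4 → ℝ) → Matrix (Fin 4) (Fin 4) ℝ}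
    {x : Fin 4 → ℝ} {M : Matrix (Fin 4) (Fin 4) ℝ} (hUV : ∀ y, U y * V y = M)
    (hU : ∀ b c, DifferentiableAt ℝ (fun y => U y b c) x)
    (hV : ∀ b c, DifferentiableAt ℝ (fun y => V y b c) x) (b c : Fin 4) :
    ∑ d, (pd a (fun y => U y b d) x * V x d c + U x b d * pd a (fun y => V y d c) x) = 0 := by
  have hconst : (fun y => ∑ d, U y b d * V y d c) = fun _ => M b c := by
    ext y
    rw [← hUV y, Matrix.mul_apply]
  have hsum : pd a (fun y => ∑ d, U y b d * V y d c) x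
      = ∑ d, pd a (fun y => U y b d * V y d c) x := by
    simp only [pd]
    rw [fderiv_fun_sum (A := fun d y => U y b d * V y d c)
      fun d _ => (hU b d).mul (hV d c), _root_.sum_apply]
  simp only [← pd_mul a (hU b _) (hV _ c), ← hsum, hconst]
  simp [pd]

theorem sum_christoffel_mul {g : (Fin 4 → ℝ) → ℝ → Matrix (Fin 4) (Fin 4) ℝ} {x : Fin 4 → ℝ} {l : ℝ}
    (hsym : (g x l).IsSymm) (hinv : IsUnit (g x l).det) (a b c : Fin 4) :
    ∑ d, christoffel g x l d a b * g x l d c = (1 / 2) * (pd a (fun y => g y l c b) x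
      + pd b (fun y => g y l a c) x - pd c (fun y => g y l a b) x) := by
  have hδ : ∀ e, ∑ d, (g x l)⁻¹ d e * g x l d c = (1 : Matrix (Fin 4) (Fin 4) ℝ) e c := by
    intro e
    rw [← Matrix.nonsing_inv_mul _ hinv, Matrix.mul_apply]
    refine Finset.sum_congr rfl fun d _ => ?_
    have hsym' : (g x l)⁻¹.IsSymm := by
      rw [Matrix.IsSymm, Matrix.transpose_nonsing_inv, hsym.eq]
    rw [hsym'.apply]
  simp only [christoffel]
  set C : Fin 4 → ℝ := fun e => pd a (fun y => g y l e b) x + pd b (fun y => g y l a e) x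
    - pd e (fun y => g y l a b) x with hC
  calc ∑ d, (1 / 2) * (∑ e, (g x l)⁻¹ d e * C e) * g x l d c
      = (1 / 2) * ∑ e, C e * ∑ d, (g x l)⁻¹ d e * g x l d c := by
        simp only [Finset.mul_sum, Finset.sum_mul]
        rw [Finset.sum_comm]
        exact Finset.sum_congr rfl fun _ _ => Finset.sum_congr rfl fun _ _ => by ring
    _ = (1 / 2) * C c := by simp [hδ, Matrix.one_apply]

/-- The Levi-Civita connection is compatible with the metric. -/
theorem pd_eq_sum_christoffel {g : (Fin 4 → ℝ) → ℝ → Matrix (Fin 4) (Fin 4) ℝ} {l : ℝ}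
    (hsym : ∀ y, (g y l).IsSymm) {x : Fin 4 → ℝ} (hinv : IsUnit (g x l).det) (a b c : Fin 4) :
    pd a (fun y => g y l b c) x
      = ∑ d, (christoffel g x l d a b * g x l d c + christoffel g x l d a c * g x l b d) := by
  have hswap : ∀ b c, (fun y => g y l b c) = fun y => g y l c b := fun b c =>
    funext fun y => (hsym y).apply c b
  have hb : ∀ d, g x l b d = g x l d b := fun d => (hsym x).apply d b
  simp only [hb, Finset.sum_add_distrib, sum_christoffel_mul (hsym x) hinv]
  rw [hswap c b, hswap a c]
  ring

/-- If `U` satisfies `U g = m` with `m` scalar and `g` is invertible at `x`, then the covariant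
derivative of `U` vanishes. -/
theorem pd_add_sum_christoffel_eq_zero {g : (Fin 4 → ℝ) → ℝ → Matrix (Fin 4) (Fin 4) ℝ} {l : ℝ}
    (hsym : ∀ y, (g y l).IsSymm) {x : Fin 4 → ℝ} (hinv : IsUnit (g x l).det)
    (hg : ∀ b c, DifferentiableAt ℝ (fun y => g y l b c) x)
    {U : (Fin 4 → ℝ) → Matrix (Fin 4) (Fin 4) ℝ}
    (hU : ∀ b c, DifferentiableAt ℝ (fun y => U y b c) x) {m : ℝ}
    (hUg : ∀ y, U y * g y l = m • (1 : Matrix (Fin 4) (Fin 4) ℝ)) (a b c : Fin 4) :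
    pd a (fun y => U y b c) x
      + ∑ d, (christoffel g x l b a d * U x d c + christoffel g x l c a d * U x b d) = 0 := by
  let A : Matrix (Fin 4) (Fin 4) ℝ := .of fun d b => christoffel g x l d a b
  let dU : Matrix (Fin 4) (Fin 4) ℝ := .of fun b c => pd a (fun y => U y b c) x
  let dg : Matrix (Fin 4) (Fin 4) ℝ := .of fun b c => pd a (fun y => g y l b c) x
  have hdg : dg = Aᵀ * g x l + g x l * A := by
    ext b c
    simp only [dg, A, Matrix.of_apply, Matrix.add_apply, Matrix.mul_apply, Matrix.transpose_apply,
      pd_eq_sum_christoffel hsym hinv, Finset.sum_add_distrib]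
    simp only [mul_comm]
  have hprod : dU * g x l + U x * dg = 0 := by
    ext b c
    simpa [dU, dg, Matrix.mul_apply, Finset.sum_add_distrib] using
      sum_pd_mul_add_mul_pd_eq_zero a hUg hU hg b c
  have hzero : (dU + A * U x + U x * Aᵀ) * g x l = 0 := by
    have h1 : A * U x * g x l = m • A := by rw [mul_assoc, hUg, mul_smul_comm, mul_one]
    have h2 : U x * (g x l * A) = m • A := by rw [← mul_assoc, hUg, smul_mul_assoc, one_mul]
    rw [hdg, mul_add, h2] at hprod
    rw [add_mul, add_mul, h1, mul_assoc (U x), ← hprod]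
    abel
  have hfinal : dU + A * U x + U x * Aᵀ = 0 := by
    rw [← Matrix.mul_nonsing_inv_cancel_right (g x l) (dU + A * U x + U x * Aᵀ) hinv, hzero,
      zero_mul]
  have := congrFun (congrFun hfinal b) c
  simpa [dU, A, Matrix.mul_apply, Finset.sum_add_distrib, add_assoc, mul_comm (U x b _)] using this

end ClassicalLimit

/-- The classical limit of a one-parameter family of relativistic metrics: if `g(x,λ)` is a
smooth family of symmetric matrices, invertible for `λ ∈ (0,k)`, with `g(x,0) = t(x)t(x)ᵀ` for
a smooth nonvanishing closed covector field `t`, and `H(x,λ) = −λ g(x,λ)⁻¹` extends smoothly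
to `λ = 0` with `h := H(·,0)`, then (i) `h^{ab} t_b = 0`; (ii) the Christoffel symbols of
`g(·,λ)` extend smoothly to `λ = 0`; and (iii) the limit Christoffel symbols are compatible
with the classical metrics `t_a` and `h^{ab}`. -/
theorem stmt_12 (k : ℝ) (hk : 0 < k)
    (g : (Fin 4 → ℝ) → ℝ → Matrix (Fin 4) (Fin 4) ℝ)
    (hgsmooth : ∀ a b : Fin 4, ContDiffOn ℝ (⊤ : ℕ∞) (fun p : (Fin 4 → ℝ) × ℝ => g p.1 p.2 a b)
      (Set.univ ×ˢ Set.Ico 0 k))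
    (hgsym : ∀ x : Fin 4 → ℝ, ∀ l ∈ Set.Ico (0 : ℝ) k, (g x l).IsSymm)
    (hginv : ∀ x : Fin 4 → ℝ, ∀ l ∈ Set.Ioo (0 : ℝ) k, IsUnit (g x l).det)
    (t : (Fin 4 → ℝ) → Fin 4 → ℝ) (htsmooth : ContDiff ℝ (⊤ : ℕ∞) t)
    (htne : ∀ x, t x ≠ 0)
    (htclosed : ∀ (x : Fin 4 → ℝ) (a b : Fin 4),
      pd a (fun y => t y b) x = pd b (fun y => t y a) x)
    (hg0 : ∀ x, g x 0 = vecMulVec (t x) (t x))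
    (H : (Fin 4 → ℝ) → ℝ → Matrix (Fin 4) (Fin 4) ℝ)
    (hHsmooth : ∀ a b : Fin 4, ContDiffOn ℝ (⊤ : ℕ∞) (fun p : (Fin 4 → ℝ) × ℝ => H p.1 p.2 a b)
      (Set.univ ×ˢ Set.Ico 0 k))
    (hH : ∀ x : Fin 4 → ℝ, ∀ l ∈ Set.Ioo (0 : ℝ) k, H x l = -(l • (g x l)⁻¹)) :
    (∀ x, H x 0 *ᵥ t x = 0) ∧
    ∃ Γlim : (Fin 4 → ℝ) → ℝ → Fin 4 → Fin 4 → Fin 4 → ℝ,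
      (∀ a b c : Fin 4, ContDiffOn ℝ (⊤ : ℕ∞) (fun p : (Fin 4 → ℝ) × ℝ => Γlim p.1 p.2 a b c)
        (Set.univ ×ˢ Set.Ico 0 k)) ∧
      (∀ x : Fin 4 → ℝ, ∀ l ∈ Set.Ioo (0 : ℝ) k, ∀ a b c : Fin 4,
        Γlim x l a b c = christoffel g x l a b c) ∧
      (∀ (x : Fin 4 → ℝ) (a b : Fin 4),
        pd a (fun y => t y b) x - (∑ c, Γlim x 0 c a b * t x c) = 0) ∧
      (∀ (x : Fin 4 → ℝ) (a b c : Fin 4),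
        pd a (fun y => H y 0 b c) x
          + (∑ d, (Γlim x 0 b a d * H x 0 d c + Γlim x 0 c a d * H x 0 b d)) = 0) := by
  have h0 : (0 : ℝ) ∈ Ico 0 k := ⟨le_rfl, hk⟩
  have hsub : ∀ {l : ℝ}, l ∈ Ioo 0 k → l ∈ Ico 0 k := fun hl => Ioo_subset_Ico_self hl
  have hgd : ∀ {l : ℝ}, l ∈ Ico 0 k → ∀ x b c, DifferentiableAt ℝ (fun y => g y l b c) x :=
    fun hl x b c => (hasFDerivAt_slice (hgsmooth b c) x hl).differentiableAt
  have hHd : ∀ {l : ℝ}, l ∈ Ico 0 k → ∀ x b c, DifferentiableAt ℝ (fun y => H y l b c) x :=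
    fun hl x b c => (hasFDerivAt_slice (hHsmooth b c) x hl).differentiableAt
  have htd : ∀ x b, DifferentiableAt ℝ (fun y => t y b) x := fun x b =>
    differentiableAt_pi.1 (htsmooth.differentiable (by simp) x) b
  have hpdg0 : ∀ x a b c, pd a (fun y => g y 0 b c) x
      = pd a (fun y => t y b) x * t x c + t x b * pd a (fun y => t y c) x := by
    intro x a b c
    simp only [hg0, Matrix.vecMulVec_apply]
    exact pd_mul a (htd x b) (htd x c)
  have hHg : ∀ x, ∀ l ∈ Ioo (0 : ℝ) k,
      H x l * g x l = (-l) • (1 : Matrix (Fin 4) (Fin 4) ℝ) := by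
    intro x l hl
    rw [hH x l hl, neg_mul, smul_mul_assoc, Matrix.nonsing_inv_mul _ (hginv x l hl), neg_smul]
  have hHt : ∀ x, H x 0 *ᵥ t x = 0 := by
    intro x
    obtain ⟨c, hc⟩ := Function.ne_iff.1 (htne x)
    ext b
    have hlim := eq_zero_of_continuousOn_prod_Ico (k := k)
      (f := fun p : (Fin 4 → ℝ) × ℝ => ∑ d, H p.1 p.2 b d * g p.1 p.2 d c
        + p.2 * (1 : Matrix (Fin 4) (Fin 4) ℝ) b c)
      ((continuousOn_finsetSum _ fun d _ =>
        (hHsmooth b d).continuousOn.mul (hgsmooth d c).continuousOn).add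
          (continuousOn_snd.mul continuousOn_const))
      (fun y l hl => by
        have := congrFun (congrFun (hHg y l hl) b) c
        rw [Matrix.mul_apply] at this
        simp [this]) x h0
    simp only [hg0, Matrix.vecMulVec_apply, zero_mul, add_zero, ← mul_assoc,
      ← Finset.sum_mul] at hlim
    exact (mul_eq_zero.1 hlim).resolve_right hc
  refine ⟨hHt, ?_⟩
  let N : Fin 4 → Fin 4 → Fin 4 → (Fin 4 → ℝ) × ℝ → ℝ := fun a b c p =>
    ∑ d, H p.1 p.2 a d * (-(1 / 2) * (pd b (fun y => g y p.2 d c) p.1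
      + pd c (fun y => g y p.2 b d) p.1 - pd d (fun y => g y p.2 b c) p.1))
  have hN : ∀ a b c, ContDiffOn ℝ (⊤ : ℕ∞) (N a b c) (univ ×ˢ Ico 0 k) := fun a b c =>
    ContDiffOn.sum fun d _ => (hHsmooth a d).mul (contDiffOn_const.mul
      ((((hgsmooth d c).pd_slice b).add ((hgsmooth b d).pd_slice c)).sub
        ((hgsmooth b c).pd_slice d)))
  have hN0 : ∀ a b c x, N a b c (x, 0) = 0 := by
    intro a b c x
    have hHt' : ∑ d, H x 0 a d * t x d = 0 := congrFun (hHt x) a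
    calc N a b c (x, 0) = (∑ d, H x 0 a d * t x d) * -pd b (fun y => t y c) x := by
          simp only [N, hpdg0, Finset.sum_mul]
          refine Finset.sum_congr rfl fun d _ => ?_
          rw [htclosed x c b, htclosed x b d, htclosed x c d]
          ring
      _ = 0 := by rw [hHt', zero_mul]
  choose q hq hNq using fun a b c => (hN a b c).exists_eq_smul_of_eq_zero (hN0 a b c)
  have hqΓ : ∀ x, ∀ l ∈ Ioo (0 : ℝ) k, ∀ a b c, q a b c (x, l) = christoffel g x l a b c := by
    intro x l hl a b c
    have h1 := hNq a b c (x, l) ⟨mem_univ x, hsub hl⟩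
    refine mul_left_cancel₀ hl.1.ne' (h1.symm.trans ?_)
    simp only [N, hH x l hl, christoffel, Finset.mul_sum, Matrix.neg_apply, Matrix.smul_apply,
      smul_eq_mul]
    exact Finset.sum_congr rfl fun d _ => by ring
  refine ⟨fun x l a b c => q a b c (x, l), hq, hqΓ, fun x a b => ?_, fun x a b c => ?_⟩
  · have hlim : ∀ b c, (pd a (fun y => t y b) x - ∑ d, q d a b (x, 0) * t x d) * t x c
        + (pd a (fun y => t y c) x - ∑ d, q d a c (x, 0) * t x d) * t x b = 0 := by
      intro b c
      have := eq_zero_of_continuousOn_prod_Ico (k := k)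
        (f := fun p : (Fin 4 → ℝ) × ℝ => pd a (fun y => g y p.2 b c) p.1
          - ∑ d, (q d a b p * g p.1 p.2 d c + q d a c p * g p.1 p.2 b d))
        (((hgsmooth b c).pd_slice a).continuousOn.sub (continuousOn_finsetSum _ fun d _ =>
          ((hq d a b).continuousOn.mul (hgsmooth d c).continuousOn).add
            ((hq d a c).continuousOn.mul (hgsmooth b d).continuousOn)))
        (fun y l hl => by
          simp only [hqΓ y l hl]
          exact sub_eq_zero.2
            (pd_eq_sum_christoffel (fun z => hgsym z l (hsub hl)) (hginv y l hl) a b c)) x h0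
      simp only [hpdg0] at this
      simp only [hg0, Matrix.vecMulVec_apply, Finset.sum_add_distrib] at this
      have hb : ∑ d, q d a b (x, 0) * (t x d * t x c) = (∑ d, q d a b (x, 0) * t x d) * t x c := by
        simp only [Finset.sum_mul, mul_assoc]
      have hc : ∑ d, q d a c (x, 0) * (t x b * t x d) = (∑ d, q d a c (x, 0) * t x d) * t x b := by
        simp only [Finset.sum_mul, mul_assoc, mul_comm (t x b)]
      rw [hb, hc] at this
      linear_combination this
    obtain ⟨c, hc⟩ := Function.ne_iff.1 (htne x)
    have hcc : pd a (fun y => t y c) x - ∑ d, q d a c (x, 0) * t x d = 0 :=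
      (mul_eq_zero.1 (by linarith [hlim c c] :
        (pd a (fun y => t y c) x - ∑ d, q d a c (x, 0) * t x d) * t x c = 0)).resolve_right hc
    have hbc := hlim b c
    rw [hcc, zero_mul, add_zero] at hbc
    exact (mul_eq_zero.1 hbc).resolve_right hc
  · exact eq_zero_of_continuousOn_prod_Ico (k := k)
      (f := fun p : (Fin 4 → ℝ) × ℝ => pd a (fun y => H y p.2 b c) p.1
        + ∑ d, (q b a d p * H p.1 p.2 d c + q c a d p * H p.1 p.2 b d))
      (((hHsmooth b c).pd_slice a).continuousOn.add (continuousOn_finsetSum _ fun d _ =>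
        ((hq b a d).continuousOn.mul (hHsmooth d c).continuousOn).add
          ((hq c a d).continuousOn.mul (hHsmooth b d).continuousOn)))
      (fun y l hl => by
        simp only [hqΓ y l hl]
        exact pd_add_sum_christoffel_eq_zero (fun z => hgsym z l (hsub hl)) (hginv y l hl)
          (hgd (hsub hl) y) (hHd (hsub hl) y) (fun z => hHg z l hl) a b c) x h0
end

section
/- Assume the setup and conclusions of the classical-limit construction: g : ℝ⁴ × [0,k) → M₄(ℝ) smooth symmetric, invertible for λ > 0, g(x,0) = t(x)t(x)ᵀ with t smooth, nonvanishing, closed; H : ℝ⁴ × [0,k) → M₄(ℝ) smooth with H(x,λ) = −λ g(x,λ)⁻¹ for λ > 0; and the Christoffel symbols Γ^a_{bc}(x,λ) of g(·,λ) extend smoothly to λ = 0. For each λ ∈ [0,k) let R_{bd}(x,λ) = Σ_a R^a_{bad}(x,λ) be the Ricci tensor computed from Γ(·,λ) via R^a_{bcd} = ∂_c Γ^a_{db} − ∂_d Γ^a_{cb} + Σ_e (Γ^a_{ce} Γ^e_{db} − Γ^a_{de} Γ^e_{cb}). Suppose T : ℝ⁴ × [0,k) → M₄(ℝ) is smooth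 with each T(x,λ) symmetric, and that Einstein's equation holds for every λ ∈ (0,k): R_{bd}(x,λ) = 8π ( T_{bd}(x,λ) − (1/2) g_{bd}(x,λ) T(x,λ) ), where T_{bd}(λ) = Σ_{n,m} g_{bn}(λ) g_{dm}(λ) T^{nm}(λ) and T(λ) = Σ_{n,m} g_{nm}(λ) T^{nm}(λ). Define ρ(x) := Σ_{a,b} t_a(x) t_b(x) T^{ab}(x,0). Then the limiting Ricci tensor satisfies the geometrized Poisson equation: R_{bd}(x,0) = 4π ρ(x) t_b(x) t_d(x) for all x and all b, d; moreover lim_{λ→0} T_{bd}(x,λ) = ρ(x) t_b(x) t_d(x). -/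
open Matrix Filter

/-- Riemann tensor `R^a_{bcd} = ∂_c Γ^a_{db} − ∂_d Γ^a_{cb} + Σ_e (Γ^a_{ce} Γ^e_{db} − Γ^a_{de} Γ^e_{cb})`
computed from a λ-family of Christoffel symbols. -/
noncomputable def riemOf (Γ : (Fin 4 → ℝ) → ℝ → Fin 4 → Fin 4 → Fin 4 → ℝ)
    (x : Fin 4 → ℝ) (l : ℝ) (a b c d : Fin 4) : ℝ :=
  pd c (fun y => Γ y l a d b) x - pd d (fun y => Γ y l a c b) x
    + ∑ e, (Γ x l a c e * Γ x l e d b - Γ x l a d e * Γ x l e c b)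

/-- Ricci tensor `R_{bd} = Σ_a R^a_{bad}`. -/
noncomputable def ricciOf (Γ : (Fin 4 → ℝ) → ℝ → Fin 4 → Fin 4 → Fin 4 → ℝ)
    (x : Fin 4 → ℝ) (l : ℝ) (b d : Fin 4) : ℝ :=
  ∑ a, riemOf Γ x l a b a d

/-- The lowered energy-momentum tensor `T_{bd}(λ) = Σ_{n,m} g_{bn}(λ) g_{dm}(λ) T^{nm}(λ)`. -/
noncomputable def Tlow (g T : (Fin 4 → ℝ) → ℝ → Matrix (Fin 4) (Fin 4) ℝ)
    (x : Fin 4 → ℝ) (l : ℝ) (b d : Fin 4) : ℝ :=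
  ∑ n, ∑ m, g x l b n * g x l d m * T x l n m

/-- The trace `T(λ) = Σ_{n,m} g_{nm}(λ) T^{nm}(λ)`. -/
noncomputable def Ttr (g T : (Fin 4 → ℝ) → ℝ → Matrix (Fin 4) (Fin 4) ℝ)
    (x : Fin 4 → ℝ) (l : ℝ) : ℝ :=
  ∑ n, ∑ m, g x l n m * T x l n m

/-- The partial derivatives in the first variable of a smooth function on `ℝ⁴ × [0, k)` are
continuous up to the boundary. -/
lemma continuousOn_pd_of_contDiffOn {k : ℝ} {f : (Fin 4 → ℝ) → ℝ → ℝ}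
    (hf : ContDiffOn ℝ (⊤ : ℕ∞) (fun p : (Fin 4 → ℝ) × ℝ => f p.1 p.2)
      (Set.univ ×ˢ Set.Ico 0 k)) (c : Fin 4) :
    ContinuousOn (fun p : (Fin 4 → ℝ) × ℝ => pd c (fun y => f y p.2) p.1)
      (Set.univ ×ˢ Set.Ico 0 k) := by
  set S : Set ((Fin 4 → ℝ) × ℝ) := Set.univ ×ˢ Set.Ico 0 k
  have hS : UniqueDiffOn ℝ S := uniqueDiffOn_univ.prod (uniqueDiffOn_Ico 0 k)
  have hcont : ContinuousOn (fderivWithin ℝ (fun p : (Fin 4 → ℝ) × ℝ => f p.1 p.2) S) S :=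
    hf.continuousOn_fderivWithin hS (by simp)
  have happ := hcont.clm_apply
    (continuousOn_const (c := ((Pi.single c 1, 0) : (Fin 4 → ℝ) × ℝ)))
  refine happ.congr fun p hp => ?_
  have hd := ((hf.differentiableOn (by simp)) p hp).hasFDerivWithinAt
  have hi : HasFDerivWithinAt (fun y : Fin 4 → ℝ => (y, p.2))
      (ContinuousLinearMap.inl ℝ (Fin 4 → ℝ) ℝ) Set.univ p.1 :=
    (hasFDerivAt_prodMk_left p.1 p.2).hasFDerivWithinAt
  have hmaps : Set.MapsTo (fun y : Fin 4 → ℝ => (y, p.2)) Set.univ S :=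
    fun y _ => ⟨Set.mem_univ _, hp.2⟩
  have hcomp := HasFDerivWithinAt.comp p.1 hd hi hmaps
  rw [hasFDerivWithinAt_univ] at hcomp
  have hfd := hcomp.fderiv
  simp only [pd]
  change fderiv ℝ ((fun p : (Fin 4 → ℝ) × ℝ => f p.1 p.2) ∘ fun y => (y, p.2)) p.1 _ = _
  rw [hfd]
  simp

/-- A function continuous on `ℝ⁴ × [0, k)` tends to its value at `λ = 0` along `λ ↘ 0`. -/
lemma tendsto_of_continuousOn_prod_Ico {k : ℝ} (hk : 0 < k) {f : (Fin 4 → ℝ) → ℝ → ℝ}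
    (hf : ContinuousOn (fun p : (Fin 4 → ℝ) × ℝ => f p.1 p.2) (Set.univ ×ˢ Set.Ico 0 k))
    (x : Fin 4 → ℝ) :
    Tendsto (fun l => f x l) (nhdsWithin 0 (Set.Ioo 0 k)) (nhds (f x 0)) := by
  have h : ContinuousOn (fun l => f x l) (Set.Ico 0 k) :=
    hf.comp (f := fun l : ℝ => (x, l)) (by fun_prop) (fun l hl => ⟨Set.mem_univ _, hl⟩)
  exact (h 0 ⟨le_rfl, hk⟩).mono_left (nhdsWithin_mono _ Set.Ioo_subset_Ico_self)

/-- The Ricci tensor of a family of symbols smooth on `ℝ⁴ × [0, k)` is continuous at `λ = 0`. -/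
lemma tendsto_ricciOf {k : ℝ} (hk : 0 < k) {Γ : (Fin 4 → ℝ) → ℝ → Fin 4 → Fin 4 → Fin 4 → ℝ}
    (hΓ : ∀ a b c : Fin 4, ContDiffOn ℝ (⊤ : ℕ∞) (fun p : (Fin 4 → ℝ) × ℝ => Γ p.1 p.2 a b c)
      (Set.univ ×ˢ Set.Ico 0 k)) (x : Fin 4 → ℝ) (b d : Fin 4) :
    Tendsto (fun l => ricciOf Γ x l b d) (nhdsWithin 0 (Set.Ioo 0 k))
      (nhds (ricciOf Γ x 0 b d)) := by
  have hpd : ∀ e a b c : Fin 4, Tendsto (fun l => pd e (fun y => Γ y l a b c) x)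
      (nhdsWithin 0 (Set.Ioo 0 k)) (nhds (pd e (fun y => Γ y 0 a b c) x)) := fun e a b c =>
    tendsto_of_continuousOn_prod_Ico hk (f := fun x l => pd e (fun y => Γ y l a b c) x)
      (continuousOn_pd_of_contDiffOn (f := fun x l => Γ x l a b c) (hΓ a b c) e) x
  have hval : ∀ a b c : Fin 4, Tendsto (fun l => Γ x l a b c)
      (nhdsWithin 0 (Set.Ioo 0 k)) (nhds (Γ x 0 a b c)) := fun a b c =>
    tendsto_of_continuousOn_prod_Ico hk (f := fun x l => Γ x l a b c) (hΓ a b c).continuousOn x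
  unfold ricciOf riemOf
  exact tendsto_finsetSum _ fun a _ => ((hpd _ _ _ _).sub (hpd _ _ _ _)).add <|
    tendsto_finsetSum _ fun e _ =>
      ((hval _ _ _).mul (hval _ _ _)).sub ((hval _ _ _).mul (hval _ _ _))

/-- The second part of the classical limit of general relativity: if a one-parameter family of
relativistic metrics `g(·,λ)` satisfying Einstein's equation with energy-momentum tensors
`T(·,λ)` converges (as in the classical-limit construction) to a classical spacetime, then with
`ρ := t_a t_b T^{ab}(·,0)` the limiting Ricci tensor satisfies the geometrized Poisson equation
`R_{bd}(·,0) = 4πρ t_b t_d`, and `lim_{λ→0} T_{bd}(λ) = ρ t_b t_d`. -/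
theorem stmt_13 (k : ℝ) (hk : 0 < k)
    (g : (Fin 4 → ℝ) → ℝ → Matrix (Fin 4) (Fin 4) ℝ)
    (hgsmooth : ∀ a b : Fin 4, ContDiffOn ℝ (⊤ : ℕ∞) (fun p : (Fin 4 → ℝ) × ℝ => g p.1 p.2 a b)
      (Set.univ ×ˢ Set.Ico 0 k))
    (hgsym : ∀ x : Fin 4 → ℝ, ∀ l ∈ Set.Ico (0 : ℝ) k, (g x l).IsSymm)
    (hginv : ∀ x : Fin 4 → ℝ, ∀ l ∈ Set.Ioo (0 : ℝ) k, IsUnit (g x l).det)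
    (t : (Fin 4 → ℝ) → Fin 4 → ℝ) (htsmooth : ContDiff ℝ (⊤ : ℕ∞) t)
    (htne : ∀ x, t x ≠ 0)
    (htclosed : ∀ (x : Fin 4 → ℝ) (a b : Fin 4),
      pd a (fun y => t y b) x = pd b (fun y => t y a) x)
    (hg0 : ∀ x, g x 0 = vecMulVec (t x) (t x))
    (H : (Fin 4 → ℝ) → ℝ → Matrix (Fin 4) (Fin 4) ℝ)
    (hHsmooth : ∀ a b : Fin 4, ContDiffOn ℝ (⊤ : ℕ∞) (fun p : (Fin 4 → ℝ) × ℝ => H p.1 p.2 a b)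
      (Set.univ ×ˢ Set.Ico 0 k))
    (hH : ∀ x : Fin 4 → ℝ, ∀ l ∈ Set.Ioo (0 : ℝ) k, H x l = -(l • (g x l)⁻¹))
    (Γ : (Fin 4 → ℝ) → ℝ → Fin 4 → Fin 4 → Fin 4 → ℝ)
    (hΓsmooth : ∀ a b c : Fin 4, ContDiffOn ℝ (⊤ : ℕ∞) (fun p : (Fin 4 → ℝ) × ℝ => Γ p.1 p.2 a b c)
      (Set.univ ×ˢ Set.Ico 0 k))
    (hΓ : ∀ x : Fin 4 → ℝ, ∀ l ∈ Set.Ioo (0 : ℝ) k, ∀ a b c : Fin 4,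
      Γ x l a b c = christoffel g x l a b c)
    (T : (Fin 4 → ℝ) → ℝ → Matrix (Fin 4) (Fin 4) ℝ)
    (hTsmooth : ∀ a b : Fin 4, ContDiffOn ℝ (⊤ : ℕ∞) (fun p : (Fin 4 → ℝ) × ℝ => T p.1 p.2 a b)
      (Set.univ ×ˢ Set.Ico 0 k))
    (hTsym : ∀ x : Fin 4 → ℝ, ∀ l ∈ Set.Ico (0 : ℝ) k, (T x l).IsSymm)
    (hEinstein : ∀ x : Fin 4 → ℝ, ∀ l ∈ Set.Ioo (0 : ℝ) k, ∀ b d : Fin 4,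
      ricciOf Γ x l b d
        = 8 * Real.pi * (Tlow g T x l b d - (1 / 2) * g x l b d * Ttr g T x l))
    (ρ : (Fin 4 → ℝ) → ℝ)
    (hρ : ∀ x, ρ x = ∑ a, ∑ b, t x a * t x b * T x 0 a b) :
    (∀ (x : Fin 4 → ℝ) (b d : Fin 4),
      ricciOf Γ x 0 b d = 4 * Real.pi * ρ x * t x b * t x d) ∧
    (∀ (x : Fin 4 → ℝ) (b d : Fin 4),
      Tendsto (fun l => Tlow g T x l b d) (nhdsWithin 0 (Set.Ioo 0 k))
        (nhds (ρ x * t x b * t x d))) := by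
  have hg : ∀ (x : Fin 4 → ℝ) (a b : Fin 4), Tendsto (fun l => g x l a b)
      (nhdsWithin 0 (Set.Ioo 0 k)) (nhds (t x a * t x b)) := fun x a b => by
    have h := tendsto_of_continuousOn_prod_Ico hk (f := fun x l => g x l a b)
      (hgsmooth a b).continuousOn x
    simpa only [hg0, vecMulVec_apply] using h
  have hT : ∀ (x : Fin 4 → ℝ) (a b : Fin 4), Tendsto (fun l => T x l a b)
      (nhdsWithin 0 (Set.Ioo 0 k)) (nhds (T x 0 a b)) := fun x a b =>
    tendsto_of_continuousOn_prod_Ico hk (f := fun x l => T x l a b) (hTsmooth a b).continuousOn x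
  have hTlow : ∀ (x : Fin 4 → ℝ) (b d : Fin 4), Tendsto (fun l => Tlow g T x l b d)
      (nhdsWithin 0 (Set.Ioo 0 k)) (nhds (ρ x * t x b * t x d)) := fun x b d => by
    have h : ρ x * t x b * t x d
        = ∑ n, ∑ m, (t x b * t x n) * (t x d * t x m) * T x 0 n m := by
      simp only [hρ, Finset.sum_mul]
      exact Finset.sum_congr rfl fun n _ => Finset.sum_congr rfl fun m _ => by ring
    rw [h]
    exact tendsto_finsetSum _ fun n _ => tendsto_finsetSum _ fun m _ =>
      ((hg x b n).mul (hg x d m)).mul (hT x n m)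
  have hTtr : ∀ x : Fin 4 → ℝ, Tendsto (fun l => Ttr g T x l)
      (nhdsWithin 0 (Set.Ioo 0 k)) (nhds (ρ x)) := fun x => by
    rw [hρ]
    exact tendsto_finsetSum _ fun n _ => tendsto_finsetSum _ fun m _ => (hg x n m).mul (hT x n m)
  refine ⟨fun x b d => ?_, hTlow⟩
  have hlim : Tendsto (fun l => ricciOf Γ x l b d) (nhdsWithin 0 (Set.Ioo 0 k))
      (nhds (8 * Real.pi * (ρ x * t x b * t x d - (1 / 2) * (t x b * t x d) * ρ x))) := by
    refine (((hTlow x b d).sub (((hg x b d).const_mul (1 / 2)).mul (hTtr x))).const_mul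
      (8 * Real.pi)).congr' ?_
    filter_upwards [self_mem_nhdsWithin] with l hl
    exact (hEinstein x l hl b d).symm
  have : (nhdsWithin (0 : ℝ) (Set.Ioo 0 k)).NeBot := left_nhdsWithin_Ioo_neBot hk
  rw [tendsto_nhds_unique (tendsto_ricciOf hk hΓsmooth x b d) hlim]
  ring
end
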